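/- Proposition (Appendix B.1, vanishing of the inference network): under the sparse GP setup for L latent channels, let q_S(z¹,…,z^L) := ∏_{l=1}^L N(z^l | Bμ^l, K̃ + B A^l Bᵀ) and KL_l := (1/2)(Tr(K_mm^{−1} A^l) + (μ^l)ᵀ K_mm^{−1} μ^l − m + log det K_mm − log det A^l). Define L_H^l := ∑_{i=1}^N [ log N(ỹᵢ^l | kᵢᵀ K_mm^{−1} μ^l, (σ̃ᵢ^l)²) − (1/(2(σ̃ᵢ^l)²))(K̃ᵢᵢ + Tr(A^l Λᵢ)) ] − KL_l. Then for every function f : (ℝ^N)^L → ℝ that is integrable against q_S, ∫ q_S(Z) [ f(Z) − ∑_{l=1}^L ∑_{i=1}^N log N(zᵢ^l | ỹᵢ^l, (σ̃ᵢ^l)²) ] dZ + ∑_{l=1}^L L_H^l = ∫ q_S(Z) f(Z) dZ − ∑_{l=1}^L KL_l. In particular, the right-hand side does not depend on the latent data (ỹ^l, σ̃^l), so the GP-VAE ELBO built from the Hensman bound is independent of the inference-network parameters. -/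

import Mathlib

open MeasureTheory Matrix Real
open scoped BigOperators

/-- Multivariate Gaussian density `N(x | m, S)`. -/
noncomputable def gaussN {n : ℕ} (m : Fin n → ℝ) (S : Matrix (Fin n) (Fin n) ℝ)
    (x : Fin n → ℝ) : ℝ :=
  (2 * π) ^ (-(n : ℝ) / 2) * S.det ^ (-(1 : ℝ) / 2) *
    Real.exp (-(1 / 2) * ((x - m) ⬝ᵥ (S⁻¹ *ᵥ (x - m))))

/-- One-dimensional Gaussian density `N(x | m, v)` with variance `v`. -/
noncomputable def gauss1 (x m v : ℝ) : ℝ :=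
  (2 * π * v) ^ (-(1 : ℝ) / 2) * Real.exp (-((x - m) ^ 2) / (2 * v))

open ProbabilityTheory

/-- The function `h` is integrable against the density `p`, with expectation `v`. -/
def HasExpectation {E : Type*} [MeasureSpace E] (p h : E → ℝ) (v : ℝ) : Prop :=
  Integrable (fun x => p x * h x) ∧ ∫ x, p x * h x = v

namespace HasExpectation

variable {E : Type*} [MeasureSpace E] {p : E → ℝ}

theorem add {g h : E → ℝ} {v w : ℝ} (hg : HasExpectation p g v) (hh : HasExpectation p h w) :
    HasExpectation p (fun x => g x + h x) (v + w) := by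
  simp only [HasExpectation, mul_add]
  exact ⟨hg.1.add hh.1, by rw [integral_add hg.1 hh.1, hg.2, hh.2]⟩

theorem const_mul {h : E → ℝ} {v : ℝ} (c : ℝ) (hh : HasExpectation p h v) :
    HasExpectation p (fun x => c * h x) (c * v) := by
  simp only [HasExpectation, mul_left_comm _ c]
  exact ⟨hh.1.const_mul c, by rw [integral_const_mul, hh.2]⟩

theorem const (c : ℝ) (hp : HasExpectation p (fun _ => 1) 1) :
    HasExpectation p (fun _ => c) c := by
  simpa using hp.const_mul c

theorem sum {ι : Type*} [Fintype ι] {h : ι → E → ℝ} {v : ι → ℝ}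
    (hh : ∀ i, HasExpectation p (h i) (v i)) :
    HasExpectation p (fun x => ∑ i, h i x) (∑ i, v i) := by
  simp only [HasExpectation, Finset.mul_sum]
  refine ⟨integrable_finsetSum _ fun i _ => (hh i).1, ?_⟩
  rw [integral_finsetSum _ fun i _ => (hh i).1]
  exact Finset.sum_congr rfl fun i _ => (hh i).2

theorem prod {ι : Type*} [Fintype ι] [SigmaFinite (volume : Measure E)] {q h : ι → E → ℝ}
    {v : ι → ℝ} (hh : ∀ i, HasExpectation (q i) (h i) (v i)) :
    HasExpectation (fun x : ι → E => ∏ i, q i (x i)) (fun x => ∏ i, h i (x i)) (∏ i, v i) := by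
  simp only [HasExpectation, ← Finset.prod_mul_distrib]
  refine ⟨Integrable.fintype_prod (f := fun i x => q i x * h i x) fun i => (hh i).1, ?_⟩
  rw [integral_fintype_prod_volume_eq_prod (fun i x => q i x * h i x)]
  exact Finset.prod_congr rfl fun i _ => (hh i).2

theorem eval {ι : Type*} [Fintype ι] [DecidableEq ι] [SigmaFinite (volume : Measure E)]
    {q : ι → E → ℝ} (hq : ∀ i, HasExpectation (q i) (fun _ => 1) 1) {j : ι} {h : E → ℝ} {v : ℝ}
    (hh : HasExpectation (q j) h v) :
    HasExpectation (fun x : ι → E => ∏ i, q i (x i)) (fun x => h (x j)) v := by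
  have key := prod (q := q) (h := fun i x => if i = j then h x else 1)
    (v := fun i => if i = j then v else 1) fun i => by
      by_cases hij : i = j
      · subst hij; simpa using hh
      · simpa [hij] using hq i
  simpa using key

theorem eval_mul_eval {ι : Type*} [Fintype ι] [DecidableEq ι] {q : ℝ → ℝ}
    (h0 : HasExpectation q (fun _ => 1) 1) (h1 : HasExpectation q (fun x => x) 0)
    (h2 : HasExpectation q (fun x => x * x) 1) (j k : ι) :
    HasExpectation (fun x : ι → ℝ => ∏ i, q (x i)) (fun x => x j * x k)
      (if j = k then 1 else 0) := by
  split_ifs with hjk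
  · subst hjk
    exact eval (q := fun _ => q) (fun _ => h0) h2
  · have key := prod (q := fun _ : ι => q)
      (h := fun i x => (if i = j then x else 1) * (if i = k then x else 1))
      (v := fun i => if i = j then 0 else if i = k then 0 else 1) fun i => by
        by_cases hij : i = j
        · subst hij; simpa [hjk] using h1
        · by_cases hik : i = k
          · simpa [hij, hik, Ne.symm hjk] using h1
          · simpa [hij, hik] using h0
    have hv : ∏ i, (if i = j then (0 : ℝ) else if i = k then 0 else 1) = 0 :=
      Finset.prod_eq_zero (Finset.mem_univ j) (by simp)
    rw [hv] at key
    simp only [Finset.prod_mul_distrib] at key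
    simpa using key

end HasExpectation

theorem hasExpectation_gaussianPDFReal {h : ℝ → ℝ} (hh : Integrable h (gaussianReal 0 1)) :
    HasExpectation (gaussianPDFReal 0 1) h (∫ x, h x ∂gaussianReal 0 1) := by
  refine ⟨?_, by simp [integral_gaussianReal_eq_integral_smul]⟩
  rw [gaussianReal_of_var_ne_zero _ one_ne_zero, integrable_withDensity_iff_integrable_smul'
    (measurable_gaussianPDF _ _) (ae_of_all _ fun _ => gaussianPDF_lt_top)] at hh
  simpa using hh

theorem hasExpectation_gaussianPDFReal_one :
    HasExpectation (gaussianPDFReal 0 1) (fun _ => 1) 1 := by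
  simpa using hasExpectation_gaussianPDFReal (integrable_const (1 : ℝ))

theorem hasExpectation_gaussianPDFReal_id :
    HasExpectation (gaussianPDFReal 0 1) (fun x => x) 0 := by
  simpa using hasExpectation_gaussianPDFReal (h := fun x => x)
    ((memLp_id_gaussianReal 1).integrable (by simp))

theorem hasExpectation_gaussianPDFReal_mul_self :
    HasExpectation (gaussianPDFReal 0 1) (fun x => x * x) 1 := by
  have hintegrable : Integrable (fun x : ℝ => x * x) (gaussianReal 0 1) := by
    simpa [pow_two] using (memLp_id_gaussianReal (μ := 0) (v := 1) 2).integrable_sq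
  have hvar := variance_of_integral_eq_zero (X := fun x : ℝ => x) (μ := gaussianReal 0 1)
    aemeasurable_id integral_id_gaussianReal
  rw [variance_fun_id_gaussianReal] at hvar
  have hsq : ∫ x : ℝ, x * x ∂gaussianReal 0 1 = 1 := by
    simpa [pow_two] using hvar.symm
  exact hsq ▸ hasExpectation_gaussianPDFReal hintegrable

/-- The density of `N(m, M Mᵀ)` at `m + M u`, times the Jacobian of `u ↦ m + M u`, is the standard
Gaussian density at `u`. -/
theorem abs_det_mul_gaussN {n : ℕ} (m : Fin n → ℝ) {M : Matrix (Fin n) (Fin n) ℝ}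
    (hM : M.det ≠ 0) (u : Fin n → ℝ) :
    |M.det| * gaussN m (M * Mᵀ) (m + M *ᵥ u) = ∏ i, gaussianPDFReal 0 1 (u i) := by
  have hquad : (M *ᵥ u) ⬝ᵥ ((M * Mᵀ)⁻¹ *ᵥ (M *ᵥ u)) = ∑ i, u i ^ 2 := by
    have hU : IsUnit M.det := isUnit_iff_ne_zero.2 hM
    have hUt : IsUnit Mᵀ.det := by rwa [det_transpose]
    rw [Matrix.mul_inv_rev, mulVec_mulVec, Matrix.mul_assoc, nonsing_inv_mul _ hU, Matrix.mul_one,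
      dotProduct_comm, dotProduct_mulVec, ← mulVec_transpose, mulVec_mulVec, mul_nonsing_inv _ hUt,
      one_mulVec]
    simp [dotProduct, pow_two]
  have hdet : (M * Mᵀ).det ^ (-(1 : ℝ) / 2) = |M.det|⁻¹ := by
    rw [det_mul, det_transpose, ← pow_two, neg_div, rpow_neg (sq_nonneg _), ← sqrt_eq_rpow,
      sqrt_sq_eq_abs]
  have hpi : (2 * π) ^ (-(n : ℝ) / 2) = (√(2 * π))⁻¹ ^ n := by
    rw [sqrt_eq_rpow, ← rpow_neg (by positivity), ← rpow_natCast, ← rpow_mul (by positivity)]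
    congr 1; ring
  simp only [gaussN, gaussianPDFReal_def, add_sub_cancel_left, hquad, hdet, hpi,
    Finset.prod_mul_distrib, ← Real.exp_sum]
  have habs : |M.det| ≠ 0 := abs_ne_zero.2 hM
  simp [Finset.mul_sum, neg_div, Finset.sum_neg_distrib]
  field_simp

theorem hasExpectation_gaussN_of_comp {n : ℕ} (m : Fin n → ℝ) {M : Matrix (Fin n) (Fin n) ℝ}
    (hM : M.det ≠ 0) {h : (Fin n → ℝ) → ℝ} {v : ℝ}
    (hh : HasExpectation (fun u => ∏ i, gaussianPDFReal 0 1 (u i)) (fun u => h (m + M *ᵥ u)) v) :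
    HasExpectation (gaussN m (M * Mᵀ)) h v := by
  let T : (Fin n → ℝ) →L[ℝ] (Fin n → ℝ) := (Matrix.toLin' M).toContinuousLinearMap
  have hU : IsUnit M := (Matrix.isUnit_iff_isUnit_det M).2 (isUnit_iff_ne_zero.2 hM)
  have hT : T.det = M.det := by
    simp [T, ContinuousLinearMap.det]
  have hderiv : ∀ u ∈ Set.univ,
      HasFDerivWithinAt (fun u => m + M *ᵥ u) T Set.univ u := fun u _ =>
    (T.hasFDerivAt.const_add m).hasFDerivWithinAt
  have hinj : Function.Injective (fun u => m + M *ᵥ u) := fun u w huw =>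
    Matrix.mulVec_injective_iff_isUnit.2 hU (add_left_cancel huw)
  have himg : (fun u => m + M *ᵥ u) '' Set.univ = Set.univ := by
    rw [Set.image_univ, Set.range_eq_univ]
    intro x
    obtain ⟨u, hu⟩ := Matrix.mulVec_surjective_iff_isUnit.2 hU (x - m)
    exact ⟨u, by simp [hu]⟩
  have hfun : (fun u => |T.det| • (gaussN m (M * Mᵀ) (m + M *ᵥ u) * h (m + M *ᵥ u)))
      = fun u => (∏ i, gaussianPDFReal 0 1 (u i)) * h (m + M *ᵥ u) := by
    funext u
    rw [← abs_det_mul_gaussN m hM u, hT, smul_eq_mul, mul_assoc]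
  have hintegrable := integrableOn_image_iff_integrableOn_abs_det_fderiv_smul volume MeasurableSet.univ
    hderiv hinj.injOn (fun x => gaussN m (M * Mᵀ) x * h x)
  have heq := integral_image_eq_integral_abs_det_fderiv_smul volume MeasurableSet.univ
    hderiv hinj.injOn (fun x => gaussN m (M * Mᵀ) x * h x)
  rw [himg, hfun, integrableOn_univ, integrableOn_univ] at hintegrable
  rw [himg, hfun, setIntegral_univ, setIntegral_univ] at heq
  exact ⟨hintegrable.2 hh.1, heq.trans hh.2⟩

theorem Matrix.PosDef.exists_eq_mul_transpose {n : Type*} [Fintype n] [DecidableEq n]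
    {S : Matrix n n ℝ} (hS : S.PosDef) : ∃ M : Matrix n n ℝ, M.det ≠ 0 ∧ S = M * Mᵀ := by
  open scoped MatrixOrder Matrix.Norms.L2Operator in
  obtain ⟨R, hR⟩ := CStarAlgebra.nonneg_iff_eq_star_mul_self.mp hS.posSemidef.nonneg
  have hSR : S = Rᵀ * Rᵀᵀ := by
    rw [hR, star_eq_conjTranspose, conjTranspose_eq_transpose_of_trivial, transpose_transpose]
  refine ⟨Rᵀ, fun h0 => hS.det_pos.ne' ?_, hSR⟩
  rw [hSR, det_mul, h0, zero_mul]

theorem hasExpectation_gaussN_one {n : ℕ} (m : Fin n → ℝ) {S : Matrix (Fin n) (Fin n) ℝ}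
    (hS : S.PosDef) : HasExpectation (gaussN m S) (fun _ => 1) 1 := by
  obtain ⟨M, hM, rfl⟩ := hS.exists_eq_mul_transpose
  refine hasExpectation_gaussN_of_comp m hM ?_
  simpa using HasExpectation.prod (ι := Fin n) fun _ => hasExpectation_gaussianPDFReal_one

theorem hasExpectation_gaussN_sub_sq {n : ℕ} (m : Fin n → ℝ) {S : Matrix (Fin n) (Fin n) ℝ}
    (hS : S.PosDef) (i : Fin n) (y : ℝ) :
    HasExpectation (gaussN m S) (fun x => (x i - y) ^ 2) (S i i + (m i - y) ^ 2) := by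
  obtain ⟨M, hM, rfl⟩ := hS.exists_eq_mul_transpose
  refine hasExpectation_gaussN_of_comp m hM ?_
  have hone := hasExpectation_gaussianPDFReal_one
  have h0 : HasExpectation (fun u : Fin n → ℝ => ∏ i, gaussianPDFReal 0 1 (u i))
      (fun _ => 1) 1 := by
    simpa using HasExpectation.prod (ι := Fin n) fun _ => hone
  have h1 := HasExpectation.sum fun j => (HasExpectation.eval (ι := Fin n)
    (q := fun _ => gaussianPDFReal 0 1) (j := j) (fun _ => hone)
    hasExpectation_gaussianPDFReal_id).const_mul (M i j)
  have h2 := HasExpectation.sum fun j => HasExpectation.sum fun k =>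
    (HasExpectation.eval_mul_eval (ι := Fin n) hone hasExpectation_gaussianPDFReal_id
      hasExpectation_gaussianPDFReal_mul_self j k).const_mul (M i j * M i k)
  have key := (h2.add (h1.const_mul (2 * (m i - y)))).add (h0.const ((m i - y) ^ 2))
  convert key using 1
  · funext u
    have hsq : ∑ j, ∑ k, M i j * M i k * (u j * u k) = (∑ j, M i j * u j) ^ 2 := by
      rw [pow_two, Finset.sum_mul_sum]
      exact Finset.sum_congr rfl fun j _ => Finset.sum_congr rfl fun k _ => by ring
    simp only [hsq, Pi.add_apply, mulVec, dotProduct]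
    ring
  · simp [Matrix.mul_apply]

theorem log_gauss1 (x m : ℝ) {v : ℝ} (hv : 0 < v) :
    Real.log (gauss1 x m v) = Real.log ((2 * π * v) ^ (-(1 : ℝ) / 2)) +
      -(1 / (2 * v)) * (x - m) ^ 2 := by
  rw [gauss1, Real.log_mul (rpow_pos_of_pos (by positivity) _).ne' (Real.exp_pos _).ne',
    Real.log_exp]
  ring

theorem stmt6 (N m L : ℕ)
    (Kmm : Matrix (Fin m) (Fin m) ℝ) (hKmm : Kmm.PosDef)
    (KNm : Matrix (Fin N) (Fin m) ℝ)
    (KNN : Matrix (Fin N) (Fin N) ℝ) (hKNN : KNN.IsSymm)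
    (B : Matrix (Fin N) (Fin m) ℝ) (hB : B = KNm * Kmm⁻¹)
    (Ktil : Matrix (Fin N) (Fin N) ℝ) (hKtil : Ktil = KNN - KNm * Kmm⁻¹ * KNmᵀ)
    (Λ : Fin N → Matrix (Fin m) (Fin m) ℝ)
    (hΛ : ∀ i, Λ i = Kmm⁻¹ * vecMulVec (KNm i) (KNm i) * Kmm⁻¹)
    (μ : Fin L → Fin m → ℝ)
    (A : Fin L → Matrix (Fin m) (Fin m) ℝ) (hA : ∀ l, (A l).PosDef)
    (hcov : ∀ l, (Ktil + B * A l * Bᵀ).PosDef)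
    (ytil : Fin L → Fin N → ℝ) (σ : Fin L → Fin N → ℝ) (hσ : ∀ l i, 0 < σ l i)
    (qS : (Fin L → Fin N → ℝ) → ℝ)
    (hqS : qS = fun Z => ∏ l, gaussN (B *ᵥ μ l) (Ktil + B * A l * Bᵀ) (Z l))
    (KL : Fin L → ℝ)
    (hKL : ∀ l, KL l = (1 / 2) * ((Kmm⁻¹ * A l).trace + (μ l) ⬝ᵥ (Kmm⁻¹ *ᵥ μ l)
      - m + Real.log Kmm.det - Real.log (A l).det))
    (LH : Fin L → ℝ)
    (hLH : ∀ l, LH l =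
      (∑ i, (Real.log (gauss1 (ytil l i) ((KNm i) ⬝ᵥ (Kmm⁻¹ *ᵥ μ l)) ((σ l i) ^ 2))
        - (1 / (2 * (σ l i) ^ 2)) * (Ktil i i + (A l * Λ i).trace))) - KL l)
    (f : (Fin L → Fin N → ℝ) → ℝ)
    (hf : Integrable (fun Z : Fin L → Fin N → ℝ => qS Z * f Z)) :
    (∫ Z : Fin L → Fin N → ℝ,
        qS Z * (f Z - ∑ l, ∑ i, Real.log (gauss1 (Z l i) (ytil l i) ((σ l i) ^ 2))))
      + ∑ l, LH l
      = (∫ Z : Fin L → Fin N → ℝ, qS Z * f Z) - ∑ l, KL l := by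
  have hcol : ∀ i, (Kmm⁻¹ *ᵥ KNm i) = B i := fun i => by
    have hsymm : (Kmm⁻¹)ᵀ = Kmm⁻¹ := by
      rw [transpose_nonsing_inv, ← conjTranspose_eq_transpose_of_trivial, hKmm.isHermitian.eq]
    rw [hB, mul_apply_eq_vecMul, ← mulVec_transpose, hsymm]
  have hmean : ∀ l i, KNm i ⬝ᵥ (Kmm⁻¹ *ᵥ μ l) = (B *ᵥ μ l) i := fun l i => by
    rw [hB, ← mulVec_mulVec]; rfl
  have htrace : ∀ l i, (A l * Λ i).trace = (B * A l * Bᵀ) i i := fun l i => by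
    have hΛB : Λ i = vecMulVec (B i) (B i) := by
      rw [hΛ, mul_vecMulVec, vecMulVec_mul, hcol, hB, mul_apply_eq_vecMul]
    rw [hΛB, mul_vecMulVec, trace_vecMulVec, Matrix.mul_assoc, dotProduct_comm]
    rfl
  have hlog : HasExpectation qS
      (fun Z => ∑ l, ∑ i, Real.log (gauss1 (Z l i) (ytil l i) ((σ l i) ^ 2)))
      (∑ l, (LH l + KL l)) := by
    rw [hqS]
    refine HasExpectation.sum fun l => ?_
    rw [hLH, sub_add_cancel]
    refine HasExpectation.sum fun i => ?_
    have hone : ∀ l, HasExpectation (gaussN (B *ᵥ μ l) (Ktil + B * A l * Bᵀ)) (fun _ => 1) 1 :=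
      fun l => hasExpectation_gaussN_one _ (hcov l)
    have hv : 0 < σ l i ^ 2 := pow_pos (hσ l i) 2
    have key := HasExpectation.eval hone
      (((hone l).const (Real.log ((2 * π * σ l i ^ 2) ^ (-(1 : ℝ) / 2)))).add
        ((hasExpectation_gaussN_sub_sq (B *ᵥ μ l) (hcov l) i (ytil l i)).const_mul
          (-(1 / (2 * σ l i ^ 2)))))
    simp only [log_gauss1 _ _ hv, hmean, htrace]
    convert key using 1
    rw [Matrix.add_apply]
    ring
  simp only [mul_sub]
  rw [integral_sub hf hlog.1, hlog.2, Finset.sum_add_distrib]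
  ring
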